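/- Let p ∈ (1,∞), q ∈ [1,∞] with p ≠ q, m ≥ 2, and λ > 0. For every β ∈ ℝ^n with β ≠ 0, the set of z ∈ ℝ^m for which max{‖z + Δβ‖_p : Δ ∈ ℝ^{m×n}, ‖Δ‖_{F_q} ≤ λ} = ‖z‖_p + λ·δ_m(p,q)·‖β‖_{q*} holds is contained in a finite union of one-dimensional linear subspaces of ℝ^m; in particular, for each β ≠ 0 the inequality max_{‖Δ‖_{F_q}≤λ} ‖z + Δβ‖_p < ‖z‖_p + λ·δ_m(p,q)·‖β‖_{q*} holds for (Lebesgue) almost all z ∈ ℝ^m. -/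

import Mathlib

open scoped ENNReal

noncomputable def lpNorm (p : ℝ≥0∞) {ι : Type*} [Fintype ι] (x : ι → ℝ) : ℝ :=
  ‖(WithLp.equiv p (ι → ℝ)).symm x‖

noncomputable def frobNorm (p : ℝ≥0∞) {m n : ℕ} (A : Matrix (Fin m) (Fin n) ℝ) : ℝ :=
  lpNorm p (fun ij : Fin m × Fin n => A ij.1 ij.2)

noncomputable def discrep (m : ℕ) (a b : ℝ≥0∞) : ℝ :=
  sSup {t : ℝ | ∃ u : Fin m → ℝ, lpNorm b u = 1 ∧ t = lpNorm a u}

theorem lpNorm_eq_norm_toLp (p : ℝ≥0∞) {ι : Type*} [Fintype ι] (x : ι → ℝ) :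
    lpNorm p x = ‖(WithLp.toLp p x : PiLp p fun _ : ι => ℝ)‖ := rfl

theorem lpNorm_nonneg (p : ℝ≥0∞) [Fact (1 ≤ p)] {ι : Type*} [Fintype ι] (x : ι → ℝ) :
    0 ≤ lpNorm p x := norm_nonneg (WithLp.toLp p x : PiLp p fun _ : ι => ℝ)

theorem lpNorm_add_le (p : ℝ≥0∞) [Fact (1 ≤ p)] {ι : Type*} [Fintype ι] (x y : ι → ℝ) :
    lpNorm p (x + y) ≤ lpNorm p x + lpNorm p y :=
  norm_add_le (WithLp.toLp p x : PiLp p fun _ : ι => ℝ) (WithLp.toLp p y)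

theorem lpNorm_smul (p : ℝ≥0∞) [Fact (1 ≤ p)] {ι : Type*} [Fintype ι] (c : ℝ) (x : ι → ℝ) :
    lpNorm p (c • x) = |c| * lpNorm p x :=
  norm_smul c (WithLp.toLp p x : PiLp p fun _ : ι => ℝ)

theorem abs_apply_le_lpNorm (p : ℝ≥0∞) [Fact (1 ≤ p)] {ι : Type*} [Fintype ι] (x : ι → ℝ)
    (i : ι) : |x i| ≤ lpNorm p x :=
  PiLp.norm_apply_le (WithLp.toLp p x : PiLp p fun _ : ι => ℝ) i

theorem lpNorm_eq_zero (p : ℝ≥0∞) [Fact (1 ≤ p)] {ι : Type*} [Fintype ι] {x : ι → ℝ} :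
    lpNorm p x = 0 ↔ x = 0 := by
  rw [lpNorm_eq_norm_toLp, norm_eq_zero]
  exact WithLp.toLp_eq_zero p

theorem lpNorm_pos (p : ℝ≥0∞) [Fact (1 ≤ p)] {ι : Type*} [Fintype ι] {x : ι → ℝ} (hx : x ≠ 0) :
    0 < lpNorm p x :=
  (lpNorm_nonneg p x).lt_of_ne' (mt (lpNorm_eq_zero p).1 hx)

theorem lpNorm_single (p : ℝ≥0∞) [Fact (1 ≤ p)] {ι : Type*} [Fintype ι] [DecidableEq ι]
    (i : ι) (c : ℝ) : lpNorm p (Pi.single i c) = |c| :=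
  PiLp.norm_single p (fun _ => ℝ) i c

theorem lpNorm_rpow {p : ℝ≥0∞} (hp : 0 < p.toReal) {ι : Type*} [Fintype ι] (x : ι → ℝ) :
    lpNorm p x ^ p.toReal = ∑ i, |x i| ^ p.toReal := by
  rw [lpNorm_eq_norm_toLp, PiLp.norm_eq_sum hp, ← Real.rpow_mul (by positivity),
    one_div_mul_cancel hp.ne', Real.rpow_one]
  rfl

theorem lpNorm_top_le {ι : Type*} [Fintype ι] {x : ι → ℝ} {c : ℝ} (hc : 0 ≤ c)
    (h : ∀ i, |x i| ≤ c) : lpNorm ⊤ x ≤ c := by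
  rw [lpNorm_eq_norm_toLp, PiLp.norm_eq_ciSup]
  exact Real.iSup_le h hc

theorem lpNorm_le_sum_abs (p : ℝ≥0∞) [Fact (1 ≤ p)] {ι : Type*} [Fintype ι] (x : ι → ℝ) :
    lpNorm p x ≤ ∑ i, |x i| := by
  classical
  have h : (WithLp.toLp p x : PiLp p fun _ : ι => ℝ)
      = ∑ i, WithLp.toLp p (Pi.single i (x i) : ι → ℝ) := by
    ext j
    simp [Finset.sum_apply, Pi.single_apply]
  rw [lpNorm_eq_norm_toLp, h]
  refine (norm_sum_le _ _).trans (Finset.sum_le_sum fun i _ => ?_)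
  exact (lpNorm_single p i (x i)).le

theorem lpNorm_le_card_mul (p q : ℝ≥0∞) [Fact (1 ≤ p)] [Fact (1 ≤ q)] {ι : Type*} [Fintype ι]
    (x : ι → ℝ) : lpNorm p x ≤ Fintype.card ι * lpNorm q x := by
  refine (lpNorm_le_sum_abs p x).trans ?_
  refine (Finset.sum_le_sum fun i _ => abs_apply_le_lpNorm q x i).trans ?_
  simp

/-- Hölder's inequality for the pairing of two finite sequences. -/
theorem abs_sum_mul_le_lpNorm_mul (q r : ℝ≥0∞) [hqr : q.HolderConjugate r]
    {ι : Type*} [Fintype ι] (a b : ι → ℝ) :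
    |∑ j, a j * b j| ≤ lpNorm q a * lpNorm r b := by
  have hq : Fact (1 ≤ q) := ⟨ENNReal.HolderConjugate.one_le q r⟩
  have hr : Fact (1 ≤ r) := ⟨ENNReal.HolderConjugate.one_le r q⟩
  have habs : |∑ j, a j * b j| ≤ ∑ j, |a j| * |b j| :=
    (Finset.abs_sum_le_sum_abs _ _).trans_eq (Finset.sum_congr rfl fun j _ => abs_mul _ _)
  refine habs.trans ?_
  rcases eq_or_ne q ⊤ with rfl | hq'
  · have : r = 1 := by simpa using hqr.inv_add_inv_eq_inv
    subst this
    have h1 : lpNorm 1 b = ∑ j, |b j| := PiLp.norm_eq_of_L1 _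
    rw [h1, Finset.mul_sum]
    gcongr with j
    exact abs_apply_le_lpNorm ⊤ a j
  rcases eq_or_ne r ⊤ with rfl | hr'
  · have : q = 1 := by simpa using hqr.inv_add_inv_eq_inv
    subst this
    have h1 : lpNorm 1 a = ∑ j, |a j| := PiLp.norm_eq_of_L1 _
    rw [h1, Finset.sum_mul]
    gcongr with j
    exact abs_apply_le_lpNorm ⊤ b j
  have h := ENNReal.HolderConjugate.toReal_of_ne_top (p := q) (q := r) hq' hr'
  have := Real.inner_le_Lp_mul_Lq_of_nonneg Finset.univ h (f := fun j => |a j|)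
    (g := fun j => |b j|) (fun _ _ => abs_nonneg _) (fun _ _ => abs_nonneg _)
  rw [lpNorm_eq_norm_toLp, lpNorm_eq_norm_toLp, PiLp.norm_eq_sum h.pos,
    PiLp.norm_eq_sum h.symm.pos]
  exact this

theorem frobNorm_nonneg (q : ℝ≥0∞) [Fact (1 ≤ q)] {m n : ℕ} (A : Matrix (Fin m) (Fin n) ℝ) :
    0 ≤ frobNorm q A := lpNorm_nonneg q _

theorem lpNorm_mulVec_le (q r : ℝ≥0∞) [q.HolderConjugate r] {m n : ℕ}
    (A : Matrix (Fin m) (Fin n) ℝ) (b : Fin n → ℝ) :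
    lpNorm q (A.mulVec b) ≤ frobNorm q A * lpNorm r b := by
  have hq : Fact (1 ≤ q) := ⟨ENNReal.HolderConjugate.one_le q r⟩
  have hr : Fact (1 ≤ r) := ⟨ENNReal.HolderConjugate.one_le r q⟩
  have hF := frobNorm_nonneg q A
  have hb := lpNorm_nonneg r b
  have hrow (i : Fin m) : |A.mulVec b i| ≤ lpNorm q (A i) * lpNorm r b :=
    abs_sum_mul_le_lpNorm_mul q r (A i) b
  rcases eq_or_ne q ⊤ with rfl | hq'
  · refine lpNorm_top_le (by positivity) fun i => (hrow i).trans ?_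
    gcongr
    exact lpNorm_top_le hF fun j =>
      abs_apply_le_lpNorm ⊤ (fun ij : Fin m × Fin n => A ij.1 ij.2) (i, j)
  have hpos : 0 < q.toReal := ENNReal.toReal_pos (zero_lt_one.trans_le hq.out).ne' hq'
  rw [← Real.rpow_le_rpow_iff (lpNorm_nonneg q _) (by positivity) hpos, lpNorm_rpow hpos,
    Real.mul_rpow hF hb, frobNorm, lpNorm_rpow hpos, Fintype.sum_prod_type, Finset.sum_mul]
  refine Finset.sum_le_sum fun i _ => ?_
  rw [← lpNorm_rpow hpos (A i), ← Real.mul_rpow (lpNorm_nonneg q _) hb]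
  exact Real.rpow_le_rpow (abs_nonneg _) (hrow i) hpos.le

theorem abs_midpoint_rpow_lt {r : ℝ} (hr : 1 < r) {a b : ℝ} (hab : a ≠ b) :
    |(a + b) / 2| ^ r < (|a| ^ r + |b| ^ r) / 2 := by
  have hr0 : 0 < r := by linarith
  rcases eq_or_ne |a| |b| with h | h
  · obtain rfl : a = -b := (abs_eq_abs.1 h).resolve_left hab
    have hb : b ≠ 0 := by rintro rfl; simp at hab
    have := Real.rpow_pos_of_pos (abs_pos.2 hb) r
    simp [Real.zero_rpow hr0.ne', this]
  · have hlt := (strictConvexOn_rpow hr).2 (abs_nonneg a) (abs_nonneg b) h one_half_pos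
      one_half_pos (add_halves 1)
    simp only [smul_eq_mul] at hlt
    have hle : |(a + b) / 2| ≤ 1 / 2 * |a| + 1 / 2 * |b| := by
      rw [abs_div, abs_two]; linarith [abs_add_le a b]
    linarith [Real.rpow_le_rpow (abs_nonneg _) hle hr0.le]

theorem abs_midpoint_rpow_le {r : ℝ} (hr : 1 < r) (a b : ℝ) :
    |(a + b) / 2| ^ r ≤ (|a| ^ r + |b| ^ r) / 2 := by
  rcases eq_or_ne a b with rfl | hab
  · simp
  · exact (abs_midpoint_rpow_lt hr hab).le

theorem PiLp.strictConvexSpace_real {p : ℝ≥0∞} [Fact (1 ≤ p)] (hp : 1 < p) (hp' : p ≠ ⊤)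
    {ι : Type*} [Fintype ι] : StrictConvexSpace ℝ (PiLp p fun _ : ι => ℝ) := by
  have hr : 1 < p.toReal := (ENNReal.toReal_lt_toReal ENNReal.one_ne_top hp').2 hp
  have hr0 : 0 < p.toReal := by linarith
  refine StrictConvexSpace.of_norm_combo_lt_one fun x y hx hy hxy =>
    ⟨1 / 2, 1 / 2, add_halves 1, ?_⟩
  have hpow (z : PiLp p fun _ : ι => ℝ) : ‖z‖ ^ p.toReal = ∑ i, |z i| ^ p.toReal :=
    lpNorm_rpow hr0 z.ofLp
  obtain ⟨k, hk⟩ : ∃ k, x k ≠ y k := by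
    by_contra! h
    exact hxy (PiLp.ext h)
  rw [← Real.rpow_lt_rpow_iff (norm_nonneg _) zero_le_one hr0, Real.one_rpow, hpow]
  have hcoord (i : ι) : ((1 / 2 : ℝ) • x + (1 / 2 : ℝ) • y) i = (x i + y i) / 2 := by
    simp; ring
  simp only [hcoord]
  calc ∑ i, |(x i + y i) / 2| ^ p.toReal
      < ∑ i, (|x i| ^ p.toReal + |y i| ^ p.toReal) / 2 :=
        Finset.sum_lt_sum (fun i _ => abs_midpoint_rpow_le hr _ _)
          ⟨k, Finset.mem_univ k, abs_midpoint_rpow_lt hr hk⟩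
    _ = (‖x‖ ^ p.toReal + ‖y‖ ^ p.toReal) / 2 := by
        rw [hpow, hpow, ← Finset.sum_div, Finset.sum_add_distrib]
    _ = 1 := by rw [hx, hy]; simp

theorem bddAbove_discrep (m : ℕ) (a b : ℝ≥0∞) [Fact (1 ≤ a)] [Fact (1 ≤ b)] :
    BddAbove {t : ℝ | ∃ u : Fin m → ℝ, lpNorm b u = 1 ∧ t = lpNorm a u} := by
  refine ⟨m, ?_⟩
  rintro _ ⟨u, hu, rfl⟩
  simpa [hu] using lpNorm_le_card_mul a b u

theorem lpNorm_le_discrep_mul {m : ℕ} (a b : ℝ≥0∞) [Fact (1 ≤ a)] [Fact (1 ≤ b)]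
    (u : Fin m → ℝ) : lpNorm a u ≤ discrep m a b * lpNorm b u := by
  rcases eq_or_ne u 0 with rfl | hu
  · rw [(lpNorm_eq_zero a).2 rfl, (lpNorm_eq_zero b).2 rfl, mul_zero]
  have hb := lpNorm_pos b hu
  have hinv : |(lpNorm b u)⁻¹| = (lpNorm b u)⁻¹ := abs_of_pos (inv_pos.2 hb)
  have h : lpNorm a ((lpNorm b u)⁻¹ • u) ≤ discrep m a b :=
    le_csSup (bddAbove_discrep m a b)
      ⟨_, by rw [lpNorm_smul, hinv, inv_mul_cancel₀ hb.ne'], rfl⟩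
  rwa [lpNorm_smul, hinv, inv_mul_le_iff₀ hb, mul_comm] at h

theorem one_le_discrep {m : ℕ} (hm : 0 < m) (a b : ℝ≥0∞) [Fact (1 ≤ a)] [Fact (1 ≤ b)] :
    1 ≤ discrep m a b := by
  simpa [lpNorm_single] using lpNorm_le_discrep_mul a b (Pi.single (⟨0, hm⟩ : Fin m) (1 : ℝ))

/-- A vector on which the ratio of the `ℓ_p` and `ℓ_q` norms is maximal has all its nonzero
coordinates of the same absolute value. -/
theorem exists_abs_eq_of_discrep_mul_le {m : ℕ} {p q : ℝ≥0∞} [hp1 : Fact (1 ≤ p)]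
    [hq1 : Fact (1 ≤ q)] (hp : p ≠ ⊤) (hpq : p ≠ q) {w : Fin m → ℝ} (hw : w ≠ 0)
    (h : discrep m p q * lpNorm q w ≤ lpNorm p w) :
    ∃ c : ℝ, ∀ i, |w i| = 0 ∨ |w i| = c := by
  obtain ⟨k, -⟩ := Function.ne_iff.1 hw
  have hm : 0 < m := k.pos
  have hmR : (0 : ℝ) < m := by exact_mod_cast hm
  have hppos : 0 < p.toReal := ENNReal.toReal_pos (zero_lt_one.trans_le hp1.out).ne' hp
  have hN := lpNorm_pos q hw
  have hp_one : lpNorm p (1 : Fin m → ℝ) ^ p.toReal = m := by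
    rw [lpNorm_rpow hppos]; simp
  have hone : (1 : Fin m → ℝ) ≠ 0 := Function.ne_iff.2 ⟨k, one_ne_zero⟩
  have hratio : lpNorm p (1 : Fin m → ℝ) * lpNorm q w ≤ lpNorm p w * lpNorm q (1 : Fin m → ℝ) := by
    have h1 := lpNorm_le_discrep_mul p q (1 : Fin m → ℝ)
    have h2 := lpNorm_pos q hone
    nlinarith
  have hratio' := Real.rpow_le_rpow
    (mul_nonneg (lpNorm_nonneg p _) hN.le) hratio hppos.le
  rw [Real.mul_rpow (lpNorm_nonneg p _) hN.le, Real.mul_rpow (lpNorm_nonneg p _)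
    (lpNorm_nonneg q _), hp_one, lpNorm_rpow hppos] at hratio'
  rcases eq_or_ne q ⊤ with rfl | hq
  · refine ⟨lpNorm ⊤ w, fun i => Or.inr ?_⟩
    have hle (i : Fin m) : |w i| ^ p.toReal ≤ lpNorm ⊤ w ^ p.toReal :=
      Real.rpow_le_rpow (abs_nonneg _) (abs_apply_le_lpNorm ⊤ w i) hppos.le
    have hone' : lpNorm ⊤ (1 : Fin m → ℝ) ^ p.toReal ≤ 1 :=
      Real.rpow_le_one (lpNorm_nonneg ⊤ _) (lpNorm_top_le zero_le_one fun i => by simp) hppos.le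
    have hsum : ∑ _i : Fin m, lpNorm ⊤ w ^ p.toReal ≤ ∑ i, |w i| ^ p.toReal := by
      simp only [Finset.sum_const, Finset.card_univ, Fintype.card_fin, nsmul_eq_mul]
      exact hratio'.trans (mul_le_of_le_one_right (by positivity) hone')
    have heq := (Finset.sum_eq_sum_iff_of_le fun i _ => hle i).1
      (le_antisymm (Finset.sum_le_sum fun i _ => hle i) hsum) i (Finset.mem_univ i)
    exact (Real.rpow_left_inj (abs_nonneg _) hN.le hppos.ne').1 heq
  have hqpos : 0 < q.toReal := ENNReal.toReal_pos (zero_lt_one.trans_le hq1.out).ne' hq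
  rcases hpq.lt_or_gt with hlt | hlt
  · have hr : 1 < q.toReal / p.toReal := by
      rw [one_lt_div hppos]
      exact (ENNReal.toReal_lt_toReal hp hq).2 hlt
    have hpow (t : ℝ) : (|t| ^ p.toReal) ^ (q.toReal / p.toReal) = |t| ^ q.toReal := by
      rw [← Real.rpow_mul (abs_nonneg t), mul_div_cancel₀ _ hppos.ne']
    have hq_one : lpNorm q (1 : Fin m → ℝ) ^ q.toReal = m := by
      rw [lpNorm_rpow hqpos]; simp
    have hqp {t : ℝ} (ht : 0 ≤ t) : (t ^ p.toReal) ^ (q.toReal / p.toReal) = t ^ q.toReal := by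
      simpa [abs_of_nonneg ht] using hpow t
    have hjensen := (strictConvexOn_rpow hr).eq_of_le_map_sum (t := Finset.univ)
      (w := fun _ : Fin m => (m : ℝ)⁻¹) (p := fun i => |w i| ^ p.toReal)
      (fun _ _ => by positivity) (by simp [hmR.ne']) (fun _ _ => Set.mem_Ici.2 (by positivity)) (by
        simp only [smul_eq_mul, hpow, ← Finset.mul_sum]
        rw [← lpNorm_rpow hqpos]
        have h3 := Real.rpow_le_rpow (by positivity) hratio' (zero_lt_one.trans hr).le
        rw [Real.mul_rpow hmR.le (by positivity), Real.mul_rpow (by positivity)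
          (Real.rpow_nonneg (lpNorm_nonneg _ _) _), hqp hN.le, hqp (lpNorm_nonneg _ _),
          hq_one] at h3
        rw [Real.mul_rpow (by positivity) (by positivity), Real.inv_rpow hmR.le,
          inv_mul_le_iff₀ hmR, mul_left_comm, ← mul_comm (_ ^ _) (m : ℝ),
          le_inv_mul_iff₀ (by positivity)]
        linarith)
    refine ⟨|w k|, fun i => Or.inr ?_⟩
    exact (Real.rpow_left_inj (abs_nonneg _) (abs_nonneg _) hppos.ne').1
      (hjensen (Finset.mem_univ i) (Finset.mem_univ k))
  · have hlt' : q.toReal < p.toReal := (ENNReal.toReal_lt_toReal hq hp).2 hlt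
    refine ⟨lpNorm q w, fun i => ?_⟩
    set N := lpNorm q w with hN_def
    have hNle : N ≤ lpNorm p w :=
      (le_mul_of_one_le_left hN.le (one_le_discrep hm p q)).trans h
    have hdiv (r : ℝ) (t : ℝ) : (|t| / N) ^ r = |t| ^ r / N ^ r :=
      Real.div_rpow (abs_nonneg _) hN.le r
    have h0 (i : Fin m) : 0 ≤ |w i| / N := by positivity
    have h1 (i : Fin m) : |w i| / N ≤ 1 := (div_le_one hN).2 (abs_apply_le_lpNorm q w i)
    have hle (i : Fin m) : (|w i| / N) ^ p.toReal ≤ (|w i| / N) ^ q.toReal :=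
      Real.rpow_le_rpow_of_exponent_ge_of_imp (h0 i) (h1 i) hlt'.le
        fun _ h => absurd h hppos.ne'
    have hsum : ∑ i, (|w i| / N) ^ q.toReal ≤ ∑ i, (|w i| / N) ^ p.toReal := by
      simp only [hdiv, ← Finset.sum_div]
      rw [← lpNorm_rpow hqpos, ← lpNorm_rpow hppos, ← hN_def, div_self (by positivity),
        one_le_div (by positivity)]
      exact Real.rpow_le_rpow hN.le hNle hppos.le
    have heq := (Finset.sum_eq_sum_iff_of_le fun i _ => hle i).1
      (le_antisymm (Finset.sum_le_sum fun i _ => hle i) hsum) i (Finset.mem_univ i)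
    rcases (h0 i).eq_or_lt with hz | hz
    · left
      simpa [hN.ne'] using hz.symm
    · right
      by_contra hne
      have hlt1 : |w i| / N < 1 :=
        (h1 i).lt_of_ne fun h => hne ((div_eq_one_iff_eq hN.ne').1 h)
      exact (Real.rpow_lt_rpow_of_exponent_gt hz hlt1 hlt').ne heq

/-- The supremum over the `ℓ_q` Frobenius ball is attained. -/
theorem exists_sSup_eq_lpNorm_add_mulVec {m n : ℕ} (p q : ℝ≥0∞) [Fact (1 ≤ p)] [Fact (1 ≤ q)]
    {lam : ℝ} (hlam : 0 ≤ lam) (β : Fin n → ℝ) (z : Fin m → ℝ) :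
    ∃ Δ : Matrix (Fin m) (Fin n) ℝ, frobNorm q Δ ≤ lam ∧
      sSup {t : ℝ | ∃ Δ : Matrix (Fin m) (Fin n) ℝ, frobNorm q Δ ≤ lam ∧
        t = lpNorm p (z + Δ.mulVec β)} = lpNorm p (z + Δ.mulVec β) := by
  let M (D : PiLp q fun _ : Fin m × Fin n => ℝ) : Matrix (Fin m) (Fin n) ℝ :=
    Matrix.of fun i j => D (i, j)
  have hM : Continuous fun D => lpNorm p (z + (M D).mulVec β) := by
    have hc : Continuous fun D => z + (M D).mulVec β := by
      refine continuous_const.add (Continuous.matrix_mulVec ?_ continuous_const)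
      exact continuous_matrix fun i j => PiLp.continuous_apply q _ (i, j)
    exact ((PiLp.continuous_toLp p fun _ : Fin m => ℝ).comp hc).norm
  have : ProperSpace (PiLp q fun _ : Fin m × Fin n => ℝ) := FiniteDimensional.proper ℝ _
  obtain ⟨D, hD, hmax⟩ := (isCompact_closedBall (0 : PiLp q fun _ : Fin m × Fin n => ℝ)
    lam).exists_isMaxOn ⟨0, by simpa using hlam⟩ hM.continuousOn
  refine ⟨M D, mem_closedBall_zero_iff.1 hD, IsGreatest.csSup_eq ⟨⟨M D, ?_, rfl⟩, ?_⟩⟩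
  · exact mem_closedBall_zero_iff.1 hD
  · rintro _ ⟨Δ, hΔ, rfl⟩
    exact hmax (a := WithLp.toLp q fun ij : Fin m × Fin n => Δ ij.1 ij.2)
      (mem_closedBall_zero_iff.2 hΔ)

/-- The lines spanned by the nonzero vectors with coordinates in `{-1, 0, 1}`. -/
def signLines (m : ℕ) : Set (Submodule ℝ (Fin m → ℝ)) :=
  (fun s : Fin m → SignType => ℝ ∙ fun i => ((s i : SignType) : ℝ)) '' {s | s ≠ 0}

theorem finite_signLines (m : ℕ) : (signLines m).Finite := (Set.toFinite _).image _

theorem finrank_of_mem_signLines {m : ℕ} {W : Submodule ℝ (Fin m → ℝ)} (hW : W ∈ signLines m) :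
    Module.finrank ℝ W = 1 := by
  obtain ⟨s, hs, rfl⟩ := hW
  refine finrank_span_singleton fun h => hs (funext fun i => ?_)
  have := congrFun h i
  cases hi : s i <;> simp_all

theorem exists_mem_signLines {m : ℕ} {w : Fin m → ℝ} (hw : w ≠ 0) {c : ℝ}
    (h : ∀ i, |w i| = 0 ∨ |w i| = c) : ∃ W ∈ signLines m, w ∈ W := by
  refine ⟨_, ⟨fun i => SignType.sign (w i), fun h0 => hw (funext fun i => ?_), rfl⟩, ?_⟩
  · simpa using congrFun h0 i
  · refine Submodule.mem_span_singleton.2 ⟨c, funext fun i => ?_⟩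
    rcases h i with hi | hi
    · simp [abs_eq_zero.1 hi]
    · rw [Pi.smul_apply, smul_eq_mul, ← hi]
      exact abs_mul_sign (w i)

theorem exists_mem_signLines_of_eq {m n : ℕ} (hm : 0 < m) {p q r : ℝ≥0∞} [Fact (1 ≤ p)]
    [q.HolderConjugate r] (hp1 : 1 < p) (hp2 : p ≠ ⊤) (hpq : p ≠ q) {lam : ℝ} (hlam : 0 < lam)
    {β : Fin n → ℝ} (hβ : β ≠ 0) {Δ : Matrix (Fin m) (Fin n) ℝ} (hΔ : frobNorm q Δ ≤ lam)
    {z : Fin m → ℝ}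
    (hz : lpNorm p (z + Δ.mulVec β) = lpNorm p z + lam * discrep m p q * lpNorm r β) :
    ∃ W ∈ signLines m, z ∈ W := by
  have hq : Fact (1 ≤ q) := ⟨ENNReal.HolderConjugate.one_le q r⟩
  have hr : Fact (1 ≤ r) := ⟨ENNReal.HolderConjugate.one_le r q⟩
  have hstrict := PiLp.strictConvexSpace_real hp1 hp2 (ι := Fin m)
  have hδ : 0 < discrep m p q := zero_lt_one.trans_le (one_le_discrep hm p q)
  have hβpos := lpNorm_pos r hβ
  have hpos : 0 < lam * discrep m p q * lpNorm r β := by positivity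
  set w := Δ.mulVec β
  have htri := lpNorm_add_le p z w
  have hdis := lpNorm_le_discrep_mul p q w
  have hqw : lpNorm q w ≤ lam * lpNorm r β :=
    (lpNorm_mulVec_le q r Δ β).trans (by gcongr)
  have hqw' := mul_le_mul_of_nonneg_left hqw hδ.le
  have hw : w ≠ 0 := by
    intro h0
    have := (lpNorm_eq_zero p).2 h0
    linarith
  obtain ⟨c, hc⟩ := exists_abs_eq_of_discrep_mul_le hp2 hpq hw (by linarith)
  obtain ⟨W, hW, hwW⟩ := exists_mem_signLines hw hc
  have hray : SameRay ℝ (WithLp.toLp p z : PiLp p fun _ : Fin m => ℝ) (WithLp.toLp p w) := by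
    refine sameRay_iff_norm_add.2 (le_antisymm (norm_add_le _ _) ?_)
    change lpNorm p z + lpNorm p w ≤ lpNorm p (z + w)
    linarith
  obtain ⟨a, -, ha⟩ := hray.exists_nonneg_right (mt (WithLp.toLp_eq_zero p).1 hw)
  have hza : z = a • w := congrArg WithLp.ofLp ha
  exact ⟨W, hW, hza ▸ W.smul_mem a hwW⟩

/-- For p ∈ (1,∞), p ≠ q, m ≥ 2 and β ≠ 0, the set of z attaining equality in the
regularization upper bound lies in a finite union of one-dimensional subspaces, so
the inequality is strict for (Lebesgue) almost all z. -/
theorem stmt11 {m n : ℕ} (hm : 2 ≤ m) (p q qs : ℝ≥0∞) (hp1 : 1 < p) (hp2 : p ≠ ⊤)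
    (hq : 1 ≤ q) (hpq : p ≠ q) (hqs : 1 / q + 1 / qs = 1) (lam : ℝ) (hlam : 0 < lam)
    (β : Fin n → ℝ) (hβ : β ≠ 0) :
    (∃ S : Set (Submodule ℝ (Fin m → ℝ)), S.Finite ∧
      (∀ W ∈ S, Module.finrank ℝ W = 1) ∧
      {z : Fin m → ℝ |
        sSup {t : ℝ | ∃ Δ : Matrix (Fin m) (Fin n) ℝ, frobNorm q Δ ≤ lam ∧
            t = lpNorm p (z + Δ.mulVec β)} =
          lpNorm p z + lam * discrep m p q * lpNorm qs β} ⊆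
        ⋃ W ∈ S, (W : Set (Fin m → ℝ))) ∧
    (∀ᵐ z ∂(MeasureTheory.volume : MeasureTheory.Measure (Fin m → ℝ)),
      sSup {t : ℝ | ∃ Δ : Matrix (Fin m) (Fin n) ℝ, frobNorm q Δ ≤ lam ∧
          t = lpNorm p (z + Δ.mulVec β)} <
        lpNorm p z + lam * discrep m p q * lpNorm qs β) := by
  have hp : Fact (1 ≤ p) := ⟨hp1.le⟩
  have hq' : Fact (1 ≤ q) := ⟨hq⟩
  have hconj : q.HolderConjugate qs := by
    rw [ENNReal.holderConjugate_iff]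
    simpa only [one_div] using hqs
  have hm0 : 0 < m := by omega
  have hsub (z : Fin m → ℝ) (hz : sSup {t : ℝ | ∃ Δ : Matrix (Fin m) (Fin n) ℝ,
      frobNorm q Δ ≤ lam ∧ t = lpNorm p (z + Δ.mulVec β)} =
        lpNorm p z + lam * discrep m p q * lpNorm qs β) : ∃ W ∈ signLines m, z ∈ W := by
    obtain ⟨Δ, hΔ, hmax⟩ := exists_sSup_eq_lpNorm_add_mulVec p q hlam.le β z
    exact exists_mem_signLines_of_eq hm0 hp1 hp2 hpq hlam hβ hΔ (hmax.symm.trans hz)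
  refine ⟨⟨signLines m, finite_signLines m, fun W => finrank_of_mem_signLines, fun z hz => ?_⟩, ?_⟩
  · simpa using hsub z hz
  · have hnull : ∀ᵐ z : Fin m → ℝ, ∀ W ∈ signLines m, z ∉ W := by
      rw [MeasureTheory.ae_ball_iff (finite_signLines m).countable]
      intro W hW
      have hne : W ≠ ⊤ := by
        rintro rfl
        have := finrank_of_mem_signLines hW
        rw [finrank_top, Module.finrank_fin_fun] at this
        omega
      exact MeasureTheory.measure_eq_zero_iff_ae_notMem.1
        (MeasureTheory.Measure.addHaar_submodule _ W hne)
    filter_upwards [hnull] with z hz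
    refine lt_of_le_of_ne ?_ fun heq => ?_
    · obtain ⟨Δ, hΔ, hmax⟩ := exists_sSup_eq_lpNorm_add_mulVec p q hlam.le β z
      have : Fact (1 ≤ qs) := ⟨ENNReal.HolderConjugate.one_le qs q⟩
      have hδ := (zero_le_one.trans (one_le_discrep hm0 p q))
      have hβ0 := lpNorm_nonneg qs β
      calc _ = lpNorm p (z + Δ.mulVec β) := hmax
        _ ≤ lpNorm p z + lpNorm p (Δ.mulVec β) := lpNorm_add_le p _ _
        _ ≤ lpNorm p z + discrep m p q * (frobNorm q Δ * lpNorm qs β) := by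
          gcongr
          exact (lpNorm_le_discrep_mul p q _).trans
            (mul_le_mul_of_nonneg_left (lpNorm_mulVec_le q qs Δ β) hδ)
        _ ≤ lpNorm p z + discrep m p q * (lam * lpNorm qs β) := by gcongr
        _ = lpNorm p z + lam * discrep m p q * lpNorm qs β := by ring
    · obtain ⟨W, hW, hzW⟩ := hsub z heq
      exact hz W hW hzW
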